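/- Let 0 < λ ≤ 1 and 1 ≤ q < p < ∞. Then the p→q norm of the thinning is infinite, and the divergence is asymptotically realized by geometric distributions: for every C > 0 there exists E ≥ 0 such that ‖T_λ(ω(E))‖_q > C · ‖ω(E)‖_p; in particular, sup ‖T_λ(x)‖_q/‖x‖_p over x : ℕ → ℝ with 0 < ‖x‖_p < ∞ equals ∞. -/

import Mathlib

open scoped ENNReal

/-- The thinning with parameter `λ` of a sequence `x : ℕ → ℝ`:
`(T_λ x)_n = ∑_{k} (k choose n) λ^n (1−λ)^{k−n} x_k` (the binomial coefficient vanishes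
for `k < n`, so this is the sum from `k = n`; the convention `0^0 = 1` is Lean's). -/
noncomputable def thin (lam : ℝ) (x : ℕ → ℝ) : ℕ → ℝ :=
  fun n => ∑' k : ℕ, (k.choose n : ℝ) * lam ^ n * (1 - lam) ^ (k - n) * x k

/-- The `ℓ^s` norm of a sequence, valued in `[0,∞]`. -/
noncomputable def lnorm (s : ℝ) (x : ℕ → ℝ) : ℝ≥0∞ :=
  (∑' n, ENNReal.ofReal (|x n| ^ s)) ^ (1 / s)

/-- The geometric probability distribution on `ℕ` with mean `E`:
`ω(E)_n = (1/(E+1)) (E/(E+1))^n`. -/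
noncomputable def geom (E : ℝ) : ℕ → ℝ := fun n => (1 / (E + 1)) * (E / (E + 1)) ^ n

theorem thin_geom {lam E : ℝ} (h0 : 0 ≤ lam) (h1 : lam ≤ 1) (hE : 0 ≤ E) :
    thin lam (geom E) = geom (lam * E) := by
  funext n
  have hE1 : (0 : ℝ) < E + 1 := by linarith
  have hF1 : (0 : ℝ) < lam * E + 1 := by positivity
  set t : ℝ := (1 - lam) * (E / (E + 1)) with ht
  have hr : E / (E + 1) < 1 := by rw [div_lt_one hE1]; linarith
  have hr0 : 0 ≤ E / (E + 1) := by positivity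
  have ht0 : 0 ≤ t := mul_nonneg (by linarith) hr0
  have ht1 : ‖t‖ < 1 := by
    rw [Real.norm_of_nonneg ht0]
    nlinarith
  have h1t : 1 - t = (lam * E + 1) / (E + 1) := by
    rw [ht]
    field_simp
    ring
  have key := hasSum_choose_mul_geometric_of_norm_lt_one n ht1
  have key' := key.mul_left (lam ^ n * (1 / (E + 1)) * (E / (E + 1)) ^ n)
  have hsum : HasSum (fun k : ℕ => (k.choose n : ℝ) * lam ^ n * (1 - lam) ^ (k - n) * geom E k)
      (lam ^ n * (1 / (E + 1)) * (E / (E + 1)) ^ n * (1 / (1 - t) ^ (n + 1))) := by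
    rw [← (add_left_injective n).hasSum_iff]
    · refine Eq.mp (congrArg (HasSum · _) (funext fun k => ?_)) key'
      simp only [Function.comp, geom, Nat.add_sub_cancel, ht, mul_pow, pow_add]
      ring
    · intro k hk
      have : k < n := by
        by_contra! h
        exact hk ⟨k - n, Nat.sub_add_cancel h⟩
      simp [Nat.choose_eq_zero_of_lt this]
  rw [thin, hsum.tsum_eq, h1t, geom]
  simp only [div_pow, mul_pow, pow_succ]
  field_simp

theorem lnorm_geom {s E : ℝ} (hs : 1 ≤ s) (hE : 0 ≤ E) :
    lnorm s (geom E) =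
      ENNReal.ofReal (((1 / (E + 1)) ^ s / (1 - (E / (E + 1)) ^ s)) ^ (1 / s)) := by
  have hE1 : (0 : ℝ) < E + 1 := by linarith
  have hr0 : 0 ≤ E / (E + 1) := by positivity
  have hr : E / (E + 1) < 1 := by rw [div_lt_one hE1]; linarith
  have hrs0 : 0 ≤ (E / (E + 1)) ^ s := Real.rpow_nonneg hr0 s
  have hrs : (E / (E + 1)) ^ s < 1 := Real.rpow_lt_one hr0 hr (by linarith)
  have hsum := (hasSum_geometric_of_lt_one hrs0 hrs).mul_left ((1 / (E + 1)) ^ s)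
  have hterm : ∀ n, |geom E n| ^ s = (1 / (E + 1)) ^ s * ((E / (E + 1)) ^ s) ^ n := by
    intro n
    rw [geom, abs_of_nonneg (by positivity), Real.mul_rpow (by positivity) (by positivity),
      ← Real.rpow_natCast, ← Real.rpow_natCast, ← Real.rpow_mul hr0, ← Real.rpow_mul hr0,
      mul_comm s]
  rw [lnorm]
  simp_rw [hterm]
  rw [← ENNReal.ofReal_tsum_of_nonneg (fun n => by positivity) hsum.summable, hsum.tsum_eq,
    ENNReal.ofReal_rpow_of_nonneg _ (by positivity), div_eq_mul_inv _ (1 - _)]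
  exact mul_nonneg (by positivity) (inv_nonneg.2 (by linarith))

theorem lnorm_geom_le {s E : ℝ} (hs : 1 ≤ s) (hE : 0 ≤ E) :
    lnorm s (geom E) ≤ ENNReal.ofReal ((1 / (E + 1)) ^ (1 - 1 / s)) := by
  have hE1 : (0 : ℝ) < E + 1 := by linarith
  have ha : 0 < 1 / (E + 1) := by positivity
  have hr0 : 0 ≤ E / (E + 1) := by positivity
  have hra : E / (E + 1) = 1 - 1 / (E + 1) := by field_simp; ring
  have hle : (E / (E + 1)) ^ s ≤ E / (E + 1) :=
    Real.rpow_le_self_of_le_one hr0 (by rw [hra]; linarith) hs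
  rw [lnorm_geom hs hE]
  apply ENNReal.ofReal_le_ofReal
  have h1 : 1 - 1 / s = (s - 1) * (1 / s) := by field_simp
  rw [h1, Real.rpow_mul ha.le]
  have hpos : 0 < 1 - (E / (E + 1)) ^ s := by linarith
  apply Real.rpow_le_rpow (by positivity) _ (by positivity)
  rw [Real.rpow_sub_one ha.ne']
  gcongr
  linarith

theorem le_lnorm_geom {s E : ℝ} (hs : 1 ≤ s) (hE : 0 ≤ E) :
    ENNReal.ofReal ((1 / s) ^ (1 / s) * (1 / (E + 1)) ^ (1 - 1 / s)) ≤ lnorm s (geom E) := by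
  have hE1 : (0 : ℝ) < E + 1 := by linarith
  have ha : 0 < 1 / (E + 1) := by positivity
  have hr0 : 0 ≤ E / (E + 1) := by positivity
  have hra : E / (E + 1) = 1 - 1 / (E + 1) := by field_simp; ring
  have hlt : (E / (E + 1)) ^ s < 1 :=
    Real.rpow_lt_one hr0 (by rw [hra]; linarith) (by linarith)
  have hb := one_add_mul_self_le_rpow_one_add (s := -(1 / (E + 1)))
    (by rw [← sub_nonneg]; linarith) hs
  rw [← sub_eq_add_neg 1 (1 / (E + 1)), ← hra] at hb
  rw [lnorm_geom hs hE]
  apply ENNReal.ofReal_le_ofReal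
  have h1 : 1 - 1 / s = (s - 1) * (1 / s) := by field_simp
  have hpos : 0 < 1 - (E / (E + 1)) ^ s := by linarith
  rw [h1, Real.rpow_mul ha.le, ← Real.mul_rpow (by positivity) (by positivity)]
  apply Real.rpow_le_rpow (by positivity) _ (by positivity)
  rw [Real.rpow_sub_one ha.ne', div_mul_div_comm, one_mul]
  gcongr
  linarith

theorem lnorm_geom_ne_zero {s E : ℝ} (hs : 1 ≤ s) (hE : 0 ≤ E) : lnorm s (geom E) ≠ 0 :=
  ((ENNReal.ofReal_pos.2 (by positivity)).trans_le (le_lnorm_geom hs hE)).ne'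

theorem lnorm_geom_ne_top {s E : ℝ} (hs : 1 ≤ s) (hE : 0 ≤ E) : lnorm s (geom E) ≠ ∞ :=
  ((lnorm_geom_le hs hE).trans_lt ENNReal.ofReal_lt_top).ne

theorem exists_mul_lnorm_geom_lt {lam : ℝ} (hlam0 : 0 ≤ lam) (hlam1 : lam ≤ 1)
    {p q : ℝ} (hq : 1 ≤ q) (hqp : q < p) {C : ℝ} (hC : 0 ≤ C) :
    ∃ E : ℝ, 0 ≤ E ∧ ENNReal.ofReal C * lnorm p (geom E) < lnorm q (thin lam (geom E)) := by
  have hexp : 0 < 1 / q - 1 / p :=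
    sub_pos.2 (one_div_lt_one_div_of_lt (by linarith) hqp)
  have hD : 0 < (1 / q) ^ (1 / q) := by positivity
  obtain ⟨x, hx, hx1⟩ := (((tendsto_rpow_atTop hexp).eventually_gt_atTop
    (C / (1 / q) ^ (1 / q))).and (Filter.eventually_ge_atTop 1)).exists
  have hx0 : 0 < x := by linarith
  have hE : 0 ≤ x - 1 := by linarith
  have hF : 0 ≤ lam * (x - 1) := mul_nonneg hlam0 hE
  refine ⟨x - 1, hE, ?_⟩
  rw [thin_geom hlam0 hlam1 hE]
  refine lt_of_le_of_lt (mul_le_mul_right (lnorm_geom_le (by linarith) hE) _)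
    (lt_of_lt_of_le ?_ (le_lnorm_geom hq hF))
  rw [← ENNReal.ofReal_mul hC]
  refine (ENNReal.ofReal_lt_ofReal_iff (by positivity)).2 ?_
  have hq1 : 0 ≤ 1 - 1 / q := sub_nonneg.2 (by rw [div_le_one (by linarith)]; exact hq)
  have hle : (1 / x) ^ (1 - 1 / q) ≤ (1 / (lam * (x - 1) + 1)) ^ (1 - 1 / q) := by
    apply Real.rpow_le_rpow (by positivity) _ hq1
    apply one_div_le_one_div_of_le (by linarith)
    nlinarith
  rw [sub_add_cancel]
  refine lt_of_lt_of_le ?_ (mul_le_mul_of_nonneg_left hle hD.le)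
  have hsplit : (1 / x) ^ (1 - 1 / q) = x ^ (1 / q - 1 / p) * (1 / x) ^ (1 - 1 / p) := by
    rw [one_div x, Real.inv_rpow hx0.le, Real.inv_rpow hx0.le, ← Real.rpow_neg hx0.le,
      ← Real.rpow_neg hx0.le, ← Real.rpow_add hx0]
    congr 1
    ring
  rw [hsplit, ← mul_assoc]
  have : C < (1 / q) ^ (1 / q) * x ^ (1 / q - 1 / p) := by
    rw [div_lt_iff₀ hD] at hx
    linarith
  gcongr

/-- For `0 < λ ≤ 1` and `1 ≤ q < p < ∞`, the `p → q` norm of the thinning is infinite,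
and the divergence is asymptotically realized by geometric distributions: for every
`C > 0` there is `E ≥ 0` with `‖T_λ(ω(E))‖_q > C ‖ω(E)‖_p`; in particular the supremum of
`‖T_λ(x)‖_q / ‖x‖_p` over all `x` with `0 < ‖x‖_p < ∞` equals `∞`. -/
theorem thinning_norm_infinite (lam : ℝ) (hlam0 : 0 < lam) (hlam1 : lam ≤ 1)
    (p q : ℝ) (hq : 1 ≤ q) (hqp : q < p) :
    (∀ C : ℝ, 0 < C → ∃ E : ℝ, 0 ≤ E ∧
        ENNReal.ofReal C * lnorm p (geom E) < lnorm q (thin lam (geom E))) ∧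
      (⨆ x ∈ {x : ℕ → ℝ | lnorm p x ≠ 0 ∧ lnorm p x ≠ ∞},
        lnorm q (thin lam x) / lnorm p x) = ∞ := by
  refine ⟨fun C hC => exists_mul_lnorm_geom_lt hlam0.le hlam1 hq hqp hC.le,
    ENNReal.eq_top_of_forall_nnreal_le fun r => ?_⟩
  obtain ⟨E, hE, h⟩ := exists_mul_lnorm_geom_lt hlam0.le hlam1 hq hqp r.coe_nonneg
  rw [ENNReal.ofReal_coe_nnreal] at h
  have hp : 1 ≤ p := by linarith
  have h0 := lnorm_geom_ne_zero hp hE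
  have htop := lnorm_geom_ne_top hp hE
  exact ((ENNReal.le_div_iff_mul_le (.inl h0) (.inl htop)).2 h.le).trans
    (le_iSup₂_of_le (geom E) ⟨h0, htop⟩ le_rfl)
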